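/- Let q be a prime power and let i, a, b be integers with 0 ≤ i ≤ q², i = a·q − b and 0 ≤ b ≤ q − 1 (so that a = ⌈i/q⌉). Then for every integer t ≥ q² + q, n_q(6, 2; (q²+1)·t − i) = (q⁴ + q² + 1)·t − (q² + 1)·i + max{a − 2, 0}·q. -/

import Mathlib

open scoped Classical

noncomputable section

/-- The number of elements of the multiset `S` of subspaces contained in the subspace `U`,
counted with multiplicity. -/
def cnt {F V : Type*} [Field F] [AddCommGroup V] [Module F V]
    (S : Multiset (Submodule F V)) (U : Submodule F V) : ℕ :=
  Multiset.countP (fun W => W ≤ U) S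

/-! ### Griesmer bound -/

def gries (q : ℕ) : ℕ → ℕ → ℕ
  | 0, _ => 0
  | k + 1, d => d + gries q k ((d + q - 1) / q)

theorem gries_mono (q k : ℕ) : ∀ {d d' : ℕ}, d ≤ d' → gries q k d ≤ gries q k d' := by
  induction k with
  | zero => intro d d' _; simp [gries]
  | succ k ih =>
    intro d d' h
    simp only [gries]
    exact Nat.add_le_add h (ih (Nat.div_le_div_right (by omega)))

theorem countP_cover {α ι : Type*} (M : Multiset α) (s : Finset ι) (P Q : α → Prop)
    (R : ι → α → Prop) (hT : ∀ i ∈ s, ∀ x, Q x → R i x) (hTP : ∀ x, Q x → P x)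
    (hc : ∀ x ∈ M, P x ∨ ∃ i ∈ s, R i x) :
    Multiset.card M + s.card * M.countP Q ≤ M.countP P + ∑ i ∈ s, M.countP (R i) := by
  induction M using Multiset.induction_on with
  | empty => simp
  | cons x M ih =>
    have ih' := ih (fun y hy => hc y (Multiset.mem_cons_of_mem hy))
    simp only [Multiset.countP_cons, Multiset.card_cons, Finset.sum_add_distrib, mul_add]
    have key : 1 + s.card * (if Q x then 1 else 0) ≤
        (if P x then 1 else 0) + ∑ i ∈ s, (if R i x then 1 else 0) := by
      by_cases hQ : Q x
      · have h1 : ∑ i ∈ s, (if R i x then 1 else 0) = s.card := by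
          rw [Finset.sum_congr rfl (fun i hi => if_pos (hT i hi x hQ))]
          simp
        rw [h1, if_pos hQ, if_pos (hTP x hQ)]
        omega
      · rw [if_neg hQ]
        rcases hc x (Multiset.mem_cons_self x M) with h | ⟨i, hi, h⟩
        · rw [if_pos h]; omega
        · have := Finset.single_le_sum (f := fun i => if R i x then 1 else 0)
            (fun _ _ => Nat.zero_le _) hi
          simp only [if_pos h] at this
          omega
    omega

theorem countP_imp {α : Type*} (M : Multiset α) {P Q : α → Prop} (h : ∀ x, P x → Q x) :
    M.countP P ≤ M.countP Q := by
  rw [Multiset.countP_eq_card_filter, Multiset.countP_eq_card_filter]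
  exact Multiset.card_le_card (Multiset.monotone_filter_right M h)

theorem exists_sub_finrank {F V : Type*} [Field F] [AddCommGroup V] [Module F V]
    [FiniteDimensional F V] (U : Submodule F V) (n : ℕ) (hn : n ≤ Module.finrank F U) :
    ∃ H : Submodule F V, H ≤ U ∧ Module.finrank F H = n := by
  induction n with
  | zero => exact ⟨⊥, bot_le, by simp⟩
  | succ n ih =>
    obtain ⟨H, hH, hf⟩ := ih (by omega)
    have hlt : H < U := lt_of_le_of_ne hH (by rintro rfl; omega)
    obtain ⟨u, huU, huH⟩ := SetLike.exists_of_lt hlt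
    exact ⟨H ⊔ Submodule.span F {u},
      sup_le hH ((Submodule.span_singleton_le_iff_mem _ _).2 huU), by
      rw [Submodule.finrank_sup_span_singleton huH, hf]⟩

theorem griesmer {F V : Type*} [Field F] [Fintype F] [AddCommGroup V] [Module F V]
    [FiniteDimensional F V] (k : ℕ) :
    ∀ (U : Submodule F V) (M : Multiset V) (d : ℕ), Module.finrank F U = k →
      (∀ x ∈ M, x ∈ U) →
      (∀ H : Submodule F V, H ≤ U → Module.finrank F H + 1 = k →
        M.countP (fun x => x ∈ H) + d ≤ Multiset.card M) →
      gries (Fintype.card F) k d ≤ Multiset.card M := by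
  set q := Fintype.card F with hq
  have hq2 : 1 < q := Fintype.one_lt_card
  induction k with
  | zero => intro U M d _ _ _; simp [gries]
  | succ k ih =>
    intro U M d hU hM hH
    -- hyperplane of maximal multiplicity
    have hne : ∃ H : Submodule F V, H ≤ U ∧ Module.finrank F H = k := by
      exact exists_sub_finrank U k (by omega)
    obtain ⟨H, ⟨hHU, hHk⟩, hmax⟩ : ∃ H : Submodule F V, (H ≤ U ∧ Module.finrank F H = k) ∧
        ∀ H' : Submodule F V, H' ≤ U → Module.finrank F H' = k →
          M.countP (fun x => x ∈ H') ≤ M.countP (fun x => x ∈ H) := by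
      let A : Set ℕ := {n | ∃ H : Submodule F V, (H ≤ U ∧ Module.finrank F H = k) ∧
        M.countP (fun x => x ∈ H) = n}
      have hA : A.Nonempty := by
        obtain ⟨H, h⟩ := hne
        exact ⟨_, H, h, rfl⟩
      have hB : BddAbove A := by
        refine ⟨Multiset.card M, ?_⟩
        rintro n ⟨H, _, rfl⟩
        exact Multiset.countP_le_card _ _
      obtain ⟨H, h, he⟩ := Nat.sSup_mem hA hB
      refine ⟨H, h, fun H' h1 h2 => ?_⟩
      rw [he]
      exact le_csSup hB ⟨H', ⟨h1, h2⟩, rfl⟩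
    have h0 := hH H hHU (by omega)
    obtain ⟨d', hd'⟩ := Nat.exists_eq_add_of_le (Multiset.countP_le_card (fun x => x ∈ H) M)
    have hdd : d ≤ d' := by omega
    have step := ih H (M.filter (fun x => x ∈ H)) ((d' + q - 1) / q) hHk
      (fun x hx => (Multiset.mem_filter.1 hx).2) (by
        intro T hTH hTk
        rw [← Multiset.countP_eq_card_filter, Multiset.countP_filter]
        have e1 : M.countP (fun x => x ∈ T ∧ x ∈ H) = M.countP (fun x => x ∈ T) := by
          apply Multiset.countP_congr rfl
          intro x _
          exact propext ⟨fun h => h.1, fun h => ⟨h, hTH h⟩⟩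
        rw [e1]
        have hTlt : T < H := lt_of_le_of_ne hTH (by rintro rfl; omega)
        have hHlt : H < U := lt_of_le_of_ne hHU (by rintro rfl; omega)
        obtain ⟨h, hhH, hhT⟩ := SetLike.exists_of_lt hTlt
        obtain ⟨u, huU, huH⟩ := SetLike.exists_of_lt hHlt
        have hspan : T ⊔ Submodule.span F {h} = H := by
          apply Submodule.eq_of_le_of_finrank_le
          · exact sup_le hTH ((Submodule.span_singleton_le_iff_mem _ _).2 hhH)
          · have : T < T ⊔ Submodule.span F {h} := by
              refine lt_of_le_of_ne le_sup_left (fun he => hhT ?_)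
              rw [he]
              exact Submodule.mem_sup_right (Submodule.mem_span_singleton_self h)
            have := Submodule.finrank_lt_finrank_of_lt this
            omega
        have hspanU : H ⊔ Submodule.span F {u} = U := by
          apply Submodule.eq_of_le_of_finrank_le
          · exact sup_le hHU ((Submodule.span_singleton_le_iff_mem _ _).2 huU)
          · have : H < H ⊔ Submodule.span F {u} := by
              refine lt_of_le_of_ne le_sup_left (fun he => huH ?_)
              rw [he]
              exact Submodule.mem_sup_right (Submodule.mem_span_singleton_self u)
            have := Submodule.finrank_lt_finrank_of_lt this
            omega
        have cov := countP_cover M (Finset.univ : Finset F) (fun x => x ∈ H) (fun x => x ∈ T)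
          (fun c x => x ∈ T ⊔ Submodule.span F {u + c • h})
          (fun c _ x hx => Submodule.mem_sup_left hx) (fun x hx => hTH hx) (by
            intro x hx
            have hxU := hM x hx
            rw [← hspanU] at hxU
            obtain ⟨y, hy, z, hz, rfl⟩ := Submodule.mem_sup.1 hxU
            obtain ⟨l, rfl⟩ := Submodule.mem_span_singleton.1 hz
            by_cases hl : l = 0
            · left; simpa [hl] using hy
            right
            rw [← hspan] at hy
            obtain ⟨s, hs, w, hw, rfl⟩ := Submodule.mem_sup.1 hy
            obtain ⟨m, rfl⟩ := Submodule.mem_span_singleton.1 hw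
            refine ⟨m / l, Finset.mem_univ _, Submodule.mem_sup.2
              ⟨s, hs, l • (u + (m / l) • h), Submodule.smul_mem _ _
                (Submodule.mem_span_singleton_self _), ?_⟩⟩
            rw [smul_add, smul_smul, mul_div_cancel₀ _ hl]
            abel)
        have hbd : ∑ c : F, M.countP (fun x => x ∈ T ⊔ Submodule.span F {u + c • h}) ≤
            ∑ c : F, M.countP (fun x => x ∈ H) := by
          apply Finset.sum_le_sum
          intro c _
          have hucU : u + c • h ∈ U := U.add_mem huU (U.smul_mem _ (hHU hhH))
          apply hmax
          · exact sup_le (hTH.trans hHU) ((Submodule.span_singleton_le_iff_mem _ _).2 hucU)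
          · have hnot : u + c • h ∉ H := by
              intro hc
              apply huH
              have := H.sub_mem hc (H.smul_mem c hhH)
              simpa using this
            rw [Submodule.finrank_sup_span_singleton (fun h => hnot (hTH h))]
            omega
        simp only [Finset.sum_const, Finset.card_univ, smul_eq_mul] at cov hbd
        rw [← hq] at cov hbd
        have hTle : M.countP (fun x => x ∈ T) ≤ M.countP (fun x => x ∈ H) :=
          countP_imp M (fun x hx => hTH hx)
        obtain ⟨e, he⟩ := Nat.exists_eq_add_of_le hTle
        have hde : d' ≤ q * e := by
          rw [hd', he] at cov
          rw [he] at hbd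
          nlinarith
        have : (d' + q - 1) / q ≤ e := by
          rw [Nat.div_le_iff_le_mul_add_pred (by omega)]
          omega
        omega)
    rw [← Multiset.countP_eq_card_filter] at step
    have := gries_mono q (k + 1) hdd
    refine this.trans ?_
    simp only [gries]
    omega

/-! ### From lines to points -/

theorem exists_pair_span {F V : Type*} [Field F] [AddCommGroup V] [Module F V]
    [FiniteDimensional F V] (W : Submodule F V) (hW : Module.finrank F W ≤ 2) :
    ∃ p : V × V, W = Submodule.span F {p.1, p.2} := by
  by_cases h0 : W = ⊥
  · exact ⟨(0, 0), by simp [h0]⟩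
  obtain ⟨x, hx, hx0⟩ := Submodule.exists_mem_ne_zero_of_ne_bot h0
  have hxle : Submodule.span F {x} ≤ W := (Submodule.span_singleton_le_iff_mem _ _).2 hx
  by_cases h1 : Submodule.span F {x} = W
  · exact ⟨(x, x), by simp [h1]⟩
  obtain ⟨y, hyW, hy⟩ := SetLike.exists_of_lt (lt_of_le_of_ne hxle h1)
  refine ⟨(x, y), ?_⟩
  rw [Submodule.span_insert]
  symm
  apply Submodule.eq_of_le_of_finrank_le
  · exact sup_le hxle ((Submodule.span_singleton_le_iff_mem _ _).2 hyW)
  · rw [Submodule.finrank_sup_span_singleton hy, finrank_span_singleton hx0]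
    omega

/-- The `q+1` points of the line spanned by a pair. -/
def pts {F V : Type*} [Field F] [Fintype F] [AddCommGroup V] [Module F V] (p : V × V) :
    Multiset V :=
  p.2 ::ₘ (Finset.univ : Finset F).val.map (fun c => p.1 + c • p.2)

theorem card_pts {F V : Type*} [Field F] [Fintype F] [AddCommGroup V] [Module F V]
    (p : V × V) : Multiset.card (pts (F := F) p) = Fintype.card F + 1 := by
  simp [pts]

theorem countP_pts {F V : Type*} [Field F] [Fintype F] [AddCommGroup V] [Module F V]
    (p : V × V) (H : Submodule F V) (hH : ¬ Submodule.span F {p.1, p.2} ≤ H) :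
    (pts (F := F) p).countP (fun x => x ∈ H) ≤ 1 := by
  have hH' : ¬ (p.1 ∈ H ∧ p.2 ∈ H) := by
    rintro ⟨h1, h2⟩
    apply hH
    rw [Submodule.span_le]
    rintro z (rfl | rfl) <;> assumption
  rw [pts, Multiset.countP_cons, Multiset.countP_map, ← Finset.filter_val, Finset.card_val]
  by_cases h2 : p.2 ∈ H
  · rw [if_pos h2, Finset.card_eq_zero.2]
    rw [Finset.filter_eq_empty_iff]
    intro c _ hc
    apply hH'
    refine ⟨?_, h2⟩
    simpa using H.sub_mem hc (H.smul_mem c h2)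
  · rw [if_neg h2]
    rw [add_zero, Finset.card_le_one]
    intro c hc d hd
    by_contra hcd
    apply h2
    have hc' := (Finset.mem_filter.1 hc).2
    have hd' := (Finset.mem_filter.1 hd).2
    have := H.smul_mem (c - d)⁻¹ (H.sub_mem hc' hd')
    have e : p.1 + c • p.2 - (p.1 + d • p.2) = (c - d) • p.2 := by
      rw [sub_smul]; abel
    rw [e, smul_smul, inv_mul_cancel₀ (sub_ne_zero.2 hcd), one_smul] at this
    exact this

theorem exists_points {F V : Type*} [Field F] [Fintype F] [AddCommGroup V] [Module F V]
    [FiniteDimensional F V] (S : Multiset (Submodule F V))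
    (hS : ∀ W ∈ S, Module.finrank F W ≤ 2) :
    ∃ M : Multiset V, Multiset.card M = (Fintype.card F + 1) * Multiset.card S ∧
      ∀ H : Submodule F V, M.countP (fun x => x ∈ H) ≤
        Multiset.card S + Fintype.card F * cnt S H := by
  induction S using Multiset.induction_on with
  | empty => exact ⟨0, by simp, by simp⟩
  | cons W S ih =>
    obtain ⟨M, hM, hMH⟩ := ih (fun W' h => hS W' (Multiset.mem_cons_of_mem h))
    obtain ⟨p, hp⟩ := exists_pair_span W (hS W (Multiset.mem_cons_self W S))
    refine ⟨pts (F := F) p + M, ?_, fun H => ?_⟩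
    · rw [Multiset.card_add, card_pts, hM, Multiset.card_cons]; ring
    · have h1 := hMH H
      rw [Multiset.countP_add, Multiset.card_cons]
      unfold cnt at h1 ⊢
      rw [Multiset.countP_cons]
      by_cases hW : W ≤ H
      · rw [if_pos hW]
        have := Multiset.countP_le_card (fun x => x ∈ H) (pts (F := F) p)
        rw [card_pts] at this
        rw [mul_add]
        omega
      · rw [if_neg hW]
        rw [hp] at hW
        have := countP_pts p H hW
        rw [add_zero]
        omega

theorem upper_arith (q i a b u s e A d1 d2 d3 d4 d5 : ℤ) (hq0 : 0 < q) (hi : i ≤ q ^ 2)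
    (hbq : b + 1 ≤ q) (hiab : i = a * q - b) (hs : s + i = (q ^ 2 + 1) * (i + u))
    (hn : q ^ 4 * i + (q ^ 4 + q ^ 2 + 1) * u + A * q + 1 ≤ s + e)
    (hA : a ≤ A + 2) (h1 : e ≤ d1) (c2 : d1 ≤ q * d2) (c3 : d2 ≤ q * d3) (c4 : d3 ≤ q * d4)
    (c5 : d4 ≤ q * d5) (hA0 : 0 ≤ A) (hb0 : 0 ≤ b)
    (g : q * e + (d1 + (d2 + (d3 + (d4 + d5)))) ≤ (q + 1) * (s + e)) : False := by
  have haq : a ≤ q := by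
    by_contra h
    push Not at h
    nlinarith
  have k1 : q ^ 4 * (i + u) - q ^ 2 * i + A * q + 1 ≤ e := by linarith
  have lt_of : ∀ x y : ℤ, q * x < q * y → x + 1 ≤ y := by
    intro x y h
    exact lt_of_mul_lt_mul_left h hq0.le
  have k2 : q ^ 3 * (i + u) - q * i + A + 1 ≤ d2 := by
    apply lt_of; linarith
  have k3 : q ^ 2 * (i + u) - i + 1 ≤ d3 := by
    apply lt_of; linarith
  have k4 : q * (i + u) - a + 1 ≤ d4 := by
    apply lt_of; linarith
  have k5 : i + u - 1 + 1 ≤ d5 := by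
    apply lt_of; linarith
  have hs2 : q * (s + i) = q * ((q ^ 2 + 1) * (i + u)) := by rw [hs]
  linarith

theorem upper_bound (F : Type*) [Field F] [Fintype F] (q i a b t : ℕ)
    (hq : q = Fintype.card F) (hi : i ≤ q ^ 2)
    (hb : b ≤ q - 1) (hiab : (i : ℤ) = (a : ℤ) * (q : ℤ) - (b : ℤ)) (ht : q ^ 2 + q ≤ t)
    (S : Multiset (Submodule F (Fin 6 → F))) (hS : ∀ W ∈ S, Module.finrank F W ≤ 2)
    (hH : ∀ H : Submodule F (Fin 6 → F), Module.finrank F H = 5 →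
            cnt S H ≤ (q ^ 2 + 1) * t - i) :
    Multiset.card S ≤ (q ^ 4 + q ^ 2 + 1) * t - (q ^ 2 + 1) * i + (a - 2) * q := by
  have hq1 : 1 < q := by rw [hq]; exact Fintype.one_lt_card
  by_contra hcon
  push Not at hcon
  obtain ⟨A, hA⟩ : ∃ A, a - 2 = A := ⟨_, rfl⟩
  rw [hA] at hcon
  obtain ⟨u, rfl⟩ : ∃ u, t = i + u := Nat.exists_eq_add_of_le (by nlinarith)
  obtain ⟨s, hs⟩ : ∃ s, (q ^ 2 + 1) * (i + u) - i = s := ⟨_, rfl⟩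
  have hs' : s + i = (q ^ 2 + 1) * (i + u) := by
    rw [← hs]; apply Nat.sub_add_cancel; nlinarith [Nat.zero_le (q^2*(i+u))]
  have hn0 : (q ^ 4 + q ^ 2 + 1) * (i + u) - (q ^ 2 + 1) * i =
      q ^ 4 * i + (q ^ 4 + q ^ 2 + 1) * u := by
    rw [Nat.sub_eq_iff_eq_add]
    · ring
    · nlinarith [Nat.zero_le (q^4 * (i+u)), Nat.zero_le ((q^2+1)*u)]
  rw [hn0] at hcon
  rw [hs] at hH
  set n := Multiset.card S with hn
  have hsn : s ≤ n := by
    have : i * q ^ 2 ≤ i * q ^ 4 := Nat.mul_le_mul_left _ (Nat.pow_le_pow_right (by omega) (by omega))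
    nlinarith [Nat.zero_le (q^4 * u), Nat.zero_le (A * q)]
  obtain ⟨e, he⟩ := Nat.exists_eq_add_of_le hsn
  obtain ⟨M, hM, hMH⟩ := exists_points S hS
  have g := griesmer 6 (⊤ : Submodule F (Fin 6 → F)) M (q * e) (by simp) (by simp) (by
    intro H _ hHf
    have h1 := hMH H
    have h2 := hH H (by omega)
    rw [hM, ← hq, ← hn, he]
    rw [← hq, ← hn, he] at h1
    have h3 := Nat.mul_le_mul_left q h2
    nlinarith)
  rw [hM, ← hq, ← hn] at g
  simp only [gries] at g
  have hceil : ∀ x, x ≤ q * ((x + q - 1) / q) := by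
    intro x
    have h1 := Nat.div_add_mod (x + q - 1) q
    have h2 := Nat.mod_lt (x + q - 1) (by omega : q > 0)
    omega
  have c1 := hceil (q * e)
  generalize (q * e + q - 1) / q = d1 at *
  have c2 := hceil d1
  generalize (d1 + q - 1) / q = d2 at *
  have c3 := hceil d2
  generalize (d2 + q - 1) / q = d3 at *
  have c4 := hceil d3
  generalize (d3 + q - 1) / q = d4 at *
  have c5 := hceil d4
  generalize (d4 + q - 1) / q = d5 at *
  have hd1 : e ≤ d1 := Nat.le_of_mul_le_mul_left c1 (by omega)
  rw [he] at g hcon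
  have hbq : b + 1 ≤ q := by omega
  clear hMH hM hH hS hn hn0 hs hceil
  have hA2 : a ≤ A + 2 := by omega
  zify at *
  exact upper_arith q i a b u s e A d1 d2 d3 d4 d5 (by omega) hi hbq hiab hs' (by linarith)
    hA2 hd1 c2 c3 c4 c5 (by omega) (by omega) (by linarith)

/-! ### Construction -/

theorem exists_functional {F : Type*} [Field F] (H : Submodule F (Fin 6 → F))
    (hH : Module.finrank F H = 5) :
    ∃ φ : Fin 6 → F, φ ≠ 0 ∧ ∀ x ∈ H, ∑ j, φ j * x j = 0 := by
  have hlt : H < ⊤ := by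
    refine lt_top_iff_ne_top.2 ?_
    rintro rfl
    simp at hH
  obtain ⟨f, hf, hle⟩ := Submodule.exists_le_ker_of_lt_top H hlt
  have hfx : ∀ x : Fin 6 → F, f x = ∑ j, f (Pi.single j 1) * x j := by
    intro x
    rw [LinearMap.pi_apply_eq_sum_univ f x]
    refine Finset.sum_congr rfl (fun j _ => ?_)
    rw [smul_eq_mul, mul_comm]
    congr 2
    ext k
    simp [Pi.single_apply, eq_comm]
  refine ⟨fun j => f (Pi.single j 1), ?_, ?_⟩
  · intro h
    apply hf
    ext x
    simp [congrFun h]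
  · intro x hx
    rw [← hfx]
    exact hle hx

theorem count2 {F : Type*} [Field F] [Fintype F] {k : ℕ} (ψ ψ' : Fin k → F)
    (hind : ∀ l m : F, (∀ j, l * ψ j + m * ψ' j = 0) → l = 0 ∧ m = 0) (s s' : F) :
    (Finset.univ.filter (fun w : Fin k → F =>
      ∑ j, ψ j * w j + s = 0 ∧ ∑ j, ψ' j * w j + s' = 0)).card * Fintype.card F ^ 2
      = Fintype.card F ^ k := by
  let T : (Fin k → F) →ₗ[F] F × F :=
    { toFun := fun w => (∑ j, ψ j * w j, ∑ j, ψ' j * w j)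
      map_add' := by intro x y; simp [mul_add, Finset.sum_add_distrib]
      map_smul' := by
        intro c x
        simp only [Pi.smul_apply, smul_eq_mul, RingHom.id_apply, Prod.smul_mk, Finset.mul_sum]
        congr 1 <;> exact Finset.sum_congr rfl (fun j _ => by ring) }
  have hT : ∀ w, T w = (∑ j, ψ j * w j, ∑ j, ψ' j * w j) := fun w => rfl
  have hsurj : LinearMap.range T = ⊤ := by
    by_contra hne
    obtain ⟨f, hf, hle⟩ := Submodule.exists_le_ker_of_lt_top _ (lt_top_iff_ne_top.2 hne)
    have hfx : ∀ z : F × F, f z = f (1, 0) * z.1 + f (0, 1) * z.2 := by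
      intro z
      have : z = z.1 • ((1 : F), (0 : F)) + z.2 • ((0 : F), (1 : F)) := by ext <;> simp
      conv_lhs => rw [this]
      rw [map_add, map_smul, map_smul, smul_eq_mul, smul_eq_mul]
      ring
    have := hind (f (1, 0)) (f (0, 1)) (fun j => by
      have h1 : f (T (Pi.single j 1)) = 0 := hle ⟨_, rfl⟩
      rw [hfx, hT] at h1
      simpa [Pi.single_apply] using h1)
    apply hf
    ext <;> simp [this]
  have hfib : ∀ z : F × F, (Finset.univ.filter (fun w => T w = z)).card =
      (Finset.univ.filter (fun w => T w = 0)).card := by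
    intro z
    obtain ⟨w0, hw0⟩ : ∃ w, T w = z := by
      have : z ∈ LinearMap.range T := by rw [hsurj]; trivial
      exact this
    refine Finset.card_bij' (fun w _ => w - w0) (fun w _ => w + w0) ?_ ?_ ?_ ?_
    · intro w hw
      simp only [Finset.mem_filter, Finset.mem_univ, true_and] at hw ⊢
      rw [map_sub, hw, hw0, sub_self]
    · intro w hw
      simp only [Finset.mem_filter, Finset.mem_univ, true_and] at hw ⊢
      rw [map_add, hw, hw0, zero_add]
    · intro w _; simp
    · intro w _; simp
  have htot := Finset.card_eq_sum_card_fiberwise (f := T) (s := Finset.univ)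
    (t := Finset.univ) (fun x _ => Finset.mem_coe.2 (Finset.mem_univ _))
  simp only [hfib, Finset.sum_const, Finset.card_univ, smul_eq_mul, Fintype.card_prod,
    Fintype.card_fun, Fintype.card_fin] at htot
  rw [htot]
  have := hfib (-s, -s')
  rw [← this]
  have e : (Finset.univ.filter (fun w : Fin k → F =>
      ∑ j, ψ j * w j + s = 0 ∧ ∑ j, ψ' j * w j + s' = 0)) =
      (Finset.univ.filter (fun w => T w = (-s, -s'))) := by
    apply Finset.filter_congr
    intro w _
    rw [hT, Prod.mk.injEq, eq_neg_iff_add_eq_zero, eq_neg_iff_add_eq_zero]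
  rw [e]
  ring

/-- for each `k ≥ 1` there is `c` such that `x^(k+1) - x^k - c` has no root. -/
theorem exists_noroot (F : Type*) [Field F] [Fintype F] (k : ℕ) (hk : k ≠ 0) :
    ∃ c : F, ∀ x : F, x ^ (k + 1) - x ^ k ≠ c := by
  by_contra h
  push Not at h
  have hs : Function.Surjective (fun x : F => x ^ (k + 1) - x ^ k) := h
  have hi := Finite.injective_iff_surjective.2 hs
  have : (0 : F) = 1 := hi (by simp [hk])
  exact zero_ne_one this

theorem indep4 {F : Type*} [Field F] (c p0 p1 p2 p3 : F) (hc : ∀ x : F, x ^ 4 - x ^ 3 ≠ c)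
    (hp : ¬ (p0 = 0 ∧ p1 = 0 ∧ p2 = 0 ∧ p3 = 0)) (l m : F)
    (h : ∀ j, l * (![p0, p1, p2, p3] : Fin 4 → F) j +
      m * (![p1, p2, p3, p3 + c * p0] : Fin 4 → F) j = 0) : l = 0 ∧ m = 0 := by
  have h0 := h 0
  have h1 := h 1
  have h2 := h 2
  have h3 := h 3
  simp at h0 h1 h2 h3
  by_cases hm : m = 0
  · refine ⟨?_, hm⟩
    by_contra hl
    apply hp
    simp [hm, hl] at h0 h1 h2 h3
    exact ⟨h0, h1, h2, h3⟩
  exfalso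
  obtain ⟨x, rfl⟩ : ∃ x, l = - (m * x) := ⟨-l / m, by field_simp⟩
  have e1 : p1 = x * p0 := by apply mul_left_cancel₀ hm; linear_combination h0
  have e2 : p2 = x * p1 := by apply mul_left_cancel₀ hm; linear_combination h1
  have e3 : p3 = x * p2 := by apply mul_left_cancel₀ hm; linear_combination h2
  have e4 : p3 + c * p0 = x * p3 := by apply mul_left_cancel₀ hm; linear_combination h3
  by_cases hp0 : p0 = 0
  · apply hp; simp_all
  · apply hc x
    apply mul_right_cancel₀ hp0
    rw [e3, e2, e1] at e4
    linear_combination -e4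

theorem indep3 {F : Type*} [Field F] (c p0 p1 p2 : F) (hc : ∀ x : F, x ^ 3 - x ^ 2 ≠ c)
    (hp : ¬ (p0 = 0 ∧ p1 = 0 ∧ p2 = 0)) (l m : F)
    (h : ∀ j, l * (![p0, p1, p2] : Fin 3 → F) j +
      m * (![p1, p2, p2 + c * p0] : Fin 3 → F) j = 0) : l = 0 ∧ m = 0 := by
  have h0 := h 0
  have h1 := h 1
  have h2 := h 2
  simp at h0 h1 h2
  by_cases hm : m = 0
  · refine ⟨?_, hm⟩
    by_contra hl
    apply hp
    simp [hm, hl] at h0 h1 h2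
    exact ⟨h0, h1, h2⟩
  exfalso
  obtain ⟨x, rfl⟩ : ∃ x, l = - (m * x) := ⟨-l / m, by field_simp⟩
  have e1 : p1 = x * p0 := by apply mul_left_cancel₀ hm; linear_combination h0
  have e2 : p2 = x * p1 := by apply mul_left_cancel₀ hm; linear_combination h1
  have e3 : p2 + c * p0 = x * p2 := by apply mul_left_cancel₀ hm; linear_combination h2
  by_cases hp0 : p0 = 0
  · apply hp; simp_all
  · apply hc x
    apply mul_right_cancel₀ hp0
    rw [e2, e1] at e3
    linear_combination -e3

theorem indep2 {F : Type*} [Field F] (c p0 p1 : F) (hc : ∀ x : F, x ^ 2 - x ^ 1 ≠ c)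
    (hp : ¬ (p0 = 0 ∧ p1 = 0)) (l m : F)
    (h : ∀ j, l * (![p0, p1] : Fin 2 → F) j +
      m * (![p1, p1 + c * p0] : Fin 2 → F) j = 0) : l = 0 ∧ m = 0 := by
  have h0 := h 0
  have h1 := h 1
  simp at h0 h1
  by_cases hm : m = 0
  · refine ⟨?_, hm⟩
    by_contra hl
    apply hp
    simp [hm, hl] at h0 h1
    exact ⟨h0, h1⟩
  exfalso
  obtain ⟨x, rfl⟩ : ∃ x, l = - (m * x) := ⟨-l / m, by field_simp⟩
  have e1 : p1 = x * p0 := by apply mul_left_cancel₀ hm; linear_combination h0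
  have e2 : p1 + c * p0 = x * p1 := by apply mul_left_cancel₀ hm; linear_combination h1
  by_cases hp0 : p0 = 0
  · apply hp; simp_all
  · apply hc x
    apply mul_right_cancel₀ hp0
    rw [e1] at e2
    linear_combination -e2

/-- multiset of lines spanned by the pairs `x j, y j`, `j ∈ s`. -/
def fam {F : Type*} [Field F] {ι : Type*} (s : Finset ι) (x y : ι → Fin 6 → F) :
    Multiset (Submodule F (Fin 6 → F)) :=
  s.val.map (fun j => Submodule.span F {x j, y j})

theorem finrank_pair {F : Type*} [Field F] (x y : Fin 6 → F) :
    Module.finrank F (Submodule.span F {x, y}) ≤ 2 := by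
  refine (finrank_span_le_card (R := F) ({x, y} : Set (Fin 6 → F))).trans ?_
  rw [Set.toFinset_insert, Set.toFinset_singleton]
  exact Finset.card_le_two

theorem fam_finrank {F : Type*} [Field F] {ι : Type*} (s : Finset ι) (x y : ι → Fin 6 → F)
    (W : Submodule F (Fin 6 → F)) (hW : W ∈ fam s x y) : Module.finrank F W ≤ 2 := by
  obtain ⟨j, _, rfl⟩ := Multiset.mem_map.1 hW
  exact finrank_pair _ _

theorem card_fam {F : Type*} [Field F] {ι : Type*} (s : Finset ι) (x y : ι → Fin 6 → F) :
    Multiset.card (fam s x y) = s.card := by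
  simp [fam]

theorem cnt_fam {F : Type*} [Field F] {ι : Type*} (s : Finset ι) (x y : ι → Fin 6 → F)
    (H : Submodule F (Fin 6 → F)) (φ : Fin 6 → F) (hφ : ∀ v ∈ H, ∑ j, φ j * v j = 0) :
    cnt (fam s x y) H ≤
      (s.filter (fun j => ∑ k, φ k * x j k = 0 ∧ ∑ k, φ k * y j k = 0)).card := by
  unfold cnt fam
  rw [Multiset.countP_map, ← Finset.filter_val, Finset.card_val]
  apply Finset.card_le_card
  intro j hj
  rw [Finset.mem_filter] at hj ⊢
  refine ⟨hj.1, hφ _ (hj.2 (Submodule.subset_span ?_)), hφ _ (hj.2 (Submodule.subset_span ?_))⟩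
  · simp
  · simp

/-- lines disjoint from the solid `e₀,…,e₃`. -/
def famA {F : Type*} [Field F] [Fintype F] (c : F) : Multiset (Submodule F (Fin 6 → F)) :=
  fam (Finset.univ : Finset (Fin 4 → F))
    (fun w => ![w 0, w 1, w 2, w 3, 1, 0])
    (fun w => ![c * w 3, w 0, w 1, w 2 + w 3, 0, 1])

theorem cnt_famA {F : Type*} [Field F] [Fintype F] (c : F) (hc : ∀ x : F, x ^ 4 - x ^ 3 ≠ c)
    (H : Submodule F (Fin 6 → F)) (φ : Fin 6 → F) (hφ : ∀ v ∈ H, ∑ j, φ j * v j = 0)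
    (h0 : φ ≠ 0) :
    cnt (famA c) H ≤
      if φ 0 = 0 ∧ φ 1 = 0 ∧ φ 2 = 0 ∧ φ 3 = 0 then 0 else Fintype.card F ^ 2 := by
  refine (cnt_fam _ _ _ H φ hφ).trans ?_
  split_ifs with h
  · obtain ⟨e0, e1, e2, e3⟩ := h
    rw [Nat.le_zero, Finset.card_eq_zero, Finset.filter_eq_empty_iff]
    rintro w _ ⟨h1, h2⟩
    simp [Fin.sum_univ_six, e0, e1, e2, e3] at h1 h2
    apply h0
    ext j
    fin_cases j <;> simp [*]
  · have := count2 _ _ (indep4 c (φ 0) (φ 1) (φ 2) (φ 3) hc h) (φ 4) (φ 5)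
    have hq : 0 < Fintype.card F ^ 2 := pow_pos Fintype.card_pos 2
    apply le_of_eq
    apply Nat.eq_of_mul_eq_mul_right hq
    rw [← pow_add, ← this]
    congr 2
    apply Finset.filter_congr
    intro w _
    simp only [Fin.sum_univ_six, Fin.sum_univ_four]
    simp
    intro _
    refine ⟨fun h => ?_, fun h => ?_⟩ <;> linear_combination h

def famB {F : Type*} [Field F] [Fintype F] (c c3 d : F) : Multiset (Submodule F (Fin 6 → F)) :=
  fam (Finset.univ.filter (fun p : (Fin 4 → F) × F => ¬ (p.1 3 = 0 ∧ p.2 = p.1 2)))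
    (fun p => ![p.1 0, p.1 1, p.1 2, p.1 3 + d * p.1 2, 1, 0])
    (fun p => ![c * p.1 3 + p.2 * c3, p.1 0, p.1 1 + p.2,
      p.1 2 + p.1 3 - p.2 + d * (p.1 1 + p.2), 0, 1])

/-- lines of a spread of the solid `e₀,…,e₃` different from `⟨e₀,e₁⟩`. -/
def famC {F : Type*} [Field F] [Fintype F] (c : F) : Multiset (Submodule F (Fin 6 → F)) :=
  fam (Finset.univ : Finset (Fin 2 → F))
    (fun w => ![w 0, w 1, 1, 0, 0, 0])
    (fun w => ![c * w 1, w 0 + w 1, 0, 1, 0, 0])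

theorem cnt_famC {F : Type*} [Field F] [Fintype F] (c : F) (hc : ∀ x : F, x ^ 2 - x ^ 1 ≠ c)
    (H : Submodule F (Fin 6 → F)) (φ : Fin 6 → F) (hφ : ∀ v ∈ H, ∑ j, φ j * v j = 0) :
    cnt (famC c) H ≤
      if φ 0 = 0 ∧ φ 1 = 0 then (if φ 2 = 0 ∧ φ 3 = 0 then Fintype.card F ^ 2 else 0)
        else 1 := by
  refine (cnt_fam _ _ _ H φ hφ).trans ?_
  split_ifs with h h'
  · refine (Finset.card_le_univ _).trans ?_
    simp
  · obtain ⟨e0, e1⟩ := h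
    rw [Nat.le_zero, Finset.card_eq_zero, Finset.filter_eq_empty_iff]
    rintro w _ ⟨h1, h2⟩
    simp [Fin.sum_univ_six, e0, e1] at h1 h2
    exact h' ⟨h1, h2⟩
  · have := count2 _ _ (indep2 c (φ 0) (φ 1) hc h) (φ 2) (φ 3)
    have hq : 0 < Fintype.card F ^ 2 := pow_pos Fintype.card_pos 2
    apply le_of_eq
    apply Nat.eq_of_mul_eq_mul_right hq
    rw [one_mul]
    refine Eq.trans ?_ this
    congr 2
    apply Finset.filter_congr
    intro w _
    simp only [Fin.sum_univ_six, Fin.sum_univ_two]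
    simp
    intro _
    refine ⟨fun h => ?_, fun h => ?_⟩ <;> linear_combination h

def lineL (F : Type*) [Field F] : Submodule F (Fin 6 → F) :=
  Submodule.span F {![1, 0, 0, 0, 0, 0], ![0, 1, 0, 0, 0, 0]}

theorem lineL_le {F : Type*} [Field F] 
    (H : Submodule F (Fin 6 → F)) (φ : Fin 6 → F) (hφ : ∀ v ∈ H, ∑ j, φ j * v j = 0)
    (h : lineL F ≤ H) : φ 0 = 0 ∧ φ 1 = 0 := by
  have h1 := hφ _ (h (Submodule.subset_span (Set.mem_insert _ _)))
  have h2 := hφ _ (h (Submodule.subset_span (Set.mem_insert_of_mem _ rfl)))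
  simp [Fin.sum_univ_six] at h1 h2
  exact ⟨h1, h2⟩

theorem card_famA {F : Type*} [Field F] [Fintype F] (c : F) :
    Multiset.card (famA c) = Fintype.card F ^ 4 := by
  simp [famA, card_fam]

theorem card_famC {F : Type*} [Field F] [Fintype F] (c : F) :
    Multiset.card (famC c) = Fintype.card F ^ 2 := by
  simp [famC, card_fam]

/-- reindexing the excluded pairs by `F^3` -/
theorem card_excl {F : Type*} [Field F] [Fintype F] (P : (Fin 4 → F) × F → Prop) :
    (Finset.univ.filter (fun p : (Fin 4 → F) × F => (p.1 3 = 0 ∧ p.2 = p.1 2) ∧ P p)).card =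
    (Finset.univ.filter (fun w : Fin 3 → F => P (![w 0, w 1, w 2, 0], w 2))).card := by
  symm
  refine Finset.card_bij' (fun w _ => (![w 0, w 1, w 2, 0], w 2))
    (fun p _ => ![p.1 0, p.1 1, p.1 2]) ?_ ?_ ?_ ?_
  · intro w hw
    simpa using hw
  · rintro ⟨v, k⟩ hw
    simp only [Finset.mem_filter, Finset.mem_univ, true_and] at hw ⊢
    obtain ⟨⟨h3, rfl⟩, hP⟩ := hw
    have e : (![v 0, v 1, v 2, 0] : Fin 4 → F) = v := by
      ext j
      fin_cases j <;> simp [h3]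
    simpa [e] using hP
  · intro w _
    ext j
    fin_cases j <;> simp
  · rintro ⟨v, k⟩ hw
    simp only [Finset.mem_filter, Finset.mem_univ, true_and] at hw ⊢
    obtain ⟨⟨h3, rfl⟩, hP⟩ := hw
    refine Prod.ext ?_ ?_
    · ext j
      fin_cases j <;> simp [h3]
    · simp

theorem card_famB {F : Type*} [Field F] [Fintype F] (c c3 d : F) :
    Multiset.card (famB c c3 d) + Fintype.card F ^ 3 = Fintype.card F ^ 5 := by
  rw [famB, card_fam]
  have h1 := Finset.card_filter_add_card_filter_not
    (s := (Finset.univ : Finset ((Fin 4 → F) × F))) (fun p => p.1 3 = 0 ∧ p.2 = p.1 2)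
  have h2 := card_excl (F := F) (fun _ => True)
  simp at h1 h2
  rw [h2] at h1
  simp only [not_and]
  rw [add_comm, h1]
  ring

theorem cnt_famB {F : Type*} [Field F] [Fintype F] (c c3 d : F)
    (hc : ∀ x : F, x ^ 4 - x ^ 3 ≠ c) (hc3 : ∀ x : F, x ^ 3 - x ^ 2 ≠ c3)
    (H : Submodule F (Fin 6 → F)) (φ : Fin 6 → F) (hφ : ∀ v ∈ H, ∑ j, φ j * v j = 0)
    (h0 : φ ≠ 0) :
    cnt (famB c c3 d) H + (if φ 0 = 0 ∧ φ 1 = 0 ∧ φ 2 + d * φ 3 = 0 then 0 else Fintype.card F)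
      ≤ Fintype.card F ^ 3 ∧
    ((φ 0 = 0 ∧ φ 1 = 0 ∧ φ 2 = 0 ∧ φ 3 = 0) → cnt (famB c c3 d) H = 0) := by
  have key := cnt_fam (H := H) (φ := φ) (hφ := hφ) (s := (Finset.univ.filter
    (fun p : (Fin 4 → F) × F => ¬ (p.1 3 = 0 ∧ p.2 = p.1 2))))
    (x := (fun p => ![p.1 0, p.1 1, p.1 2, p.1 3 + d * p.1 2, 1, 0]))
    (y := (fun p => ![c * p.1 3 + p.2 * c3, p.1 0, p.1 1 + p.2,
      p.1 2 + p.1 3 - p.2 + d * (p.1 1 + p.2), 0, 1]))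
  change cnt (famB c c3 d) H ≤ _ at key
  have hqpos : 0 < Fintype.card F := Fintype.card_pos
  by_cases h : φ 0 = 0 ∧ φ 1 = 0 ∧ φ 2 = 0 ∧ φ 3 = 0
  · have hz : cnt (famB c c3 d) H = 0 := by
      obtain ⟨e0, e1, e2, e3⟩ := h
      refine Nat.le_zero.1 (key.trans ?_)
      rw [Nat.le_zero, Finset.card_eq_zero, Finset.filter_eq_empty_iff]
      rintro w _ ⟨h1, h2⟩
      simp [Fin.sum_univ_six, e0, e1, e2, e3] at h1 h2
      apply h0
      ext j
      fin_cases j <;> simp [*]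
    refine ⟨?_, fun _ => hz⟩
    rw [hz, zero_add]
    split_ifs
    · exact Nat.zero_le _
    · exact Nat.le_self_pow (by norm_num) _
  refine ⟨?_, fun h' => absurd h' h⟩
  set P : (Fin 4 → F) × F → Prop := fun p =>
    ∑ k, φ k * (![p.1 0, p.1 1, p.1 2, p.1 3 + d * p.1 2, 1, 0] : Fin 6 → F) k = 0 ∧
    ∑ k, φ k * (![c * p.1 3 + p.2 * c3, p.1 0, p.1 1 + p.2,
      p.1 2 + p.1 3 - p.2 + d * (p.1 1 + p.2), 0, 1] : Fin 6 → F) k = 0 with hP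
  have hne : ¬ (φ 0 = 0 ∧ φ 1 = 0 ∧ φ 2 + d * φ 3 = 0 ∧ φ 3 = 0) := by
    rintro ⟨a0, a1, a2, a3⟩
    apply h
    simp [a3] at a2
    exact ⟨a0, a1, a2, a3⟩
  -- all pairs
  have hall : (Finset.univ.filter P).card = Fintype.card F ^ 3 := by
    have e : (Finset.univ.filter P).card = ∑ k : F, (Finset.univ.filter
        (fun w : Fin 4 → F => P (w, k))).card := by
      rw [Finset.card_eq_sum_card_fiberwise (f := Prod.snd) (s := Finset.univ.filter P)
        (t := Finset.univ) (fun x _ => Finset.mem_coe.2 (Finset.mem_univ _))]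
      refine Finset.sum_congr rfl (fun k _ => ?_)
      refine Finset.card_bij' (fun p _ => p.1) (fun w _ => (w, k)) ?_ ?_ ?_ ?_
      · rintro ⟨w, k'⟩ hw
        simp only [Finset.mem_filter, Finset.mem_univ, true_and] at hw ⊢
        obtain ⟨h1, rfl⟩ := hw
        exact h1
      · intro w hw
        simp only [Finset.mem_filter, Finset.mem_univ, true_and] at hw ⊢
        simpa using hw
      · rintro ⟨w, k'⟩ hw
        simp only [Finset.mem_filter, Finset.mem_univ, true_and] at hw ⊢
        obtain ⟨h1, rfl⟩ := hw
        rfl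
      · intro w _; rfl
    have each : ∀ k : F, (Finset.univ.filter
        (fun w : Fin 4 → F => P (w, k))).card = Fintype.card F ^ 2 := by
      intro k
      have := count2 _ _ (indep4 c (φ 0) (φ 1) (φ 2 + d * φ 3) (φ 3) hc hne) (φ 4)
        (φ 5 + k * (φ 0 * c3 + (φ 2 + d * φ 3) - φ 3))
      have hq : 0 < Fintype.card F ^ 2 := pow_pos Fintype.card_pos 2
      apply Nat.eq_of_mul_eq_mul_right hq
      rw [← pow_add, ← this]
      congr 2
      apply Finset.filter_congr
      intro w _
      simp only [hP, Fin.sum_univ_six, Fin.sum_univ_four]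
      simp
      refine and_congr ?_ ?_
      · refine ⟨fun h => ?_, fun h => ?_⟩ <;> linear_combination h
      · refine ⟨fun h => ?_, fun h => ?_⟩ <;> linear_combination h
    rw [e, Finset.sum_congr rfl (fun k _ => each k)]
    simp
    ring
  have hexcl : (if φ 0 = 0 ∧ φ 1 = 0 ∧ φ 2 + d * φ 3 = 0 then 0 else Fintype.card F) ≤
      (Finset.univ.filter (fun p : (Fin 4 → F) × F =>
        (p.1 3 = 0 ∧ p.2 = p.1 2) ∧ P p)).card := by
    split_ifs with h3
    · exact Nat.zero_le _
    refine le_of_le_of_eq ?_ ((card_excl P).symm.trans (by congr!))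
    have := count2 _ _ (indep3 c3 (φ 0) (φ 1) (φ 2 + d * φ 3) hc3 h3) (φ 4) (φ 5)
    have hq : 0 < Fintype.card F ^ 2 := pow_pos Fintype.card_pos 2
    apply le_of_eq
    apply Nat.eq_of_mul_eq_mul_right hq
    rw [← pow_succ', ← this]
    congr 2
    ext w
    simp only [Finset.mem_filter, Finset.mem_univ, true_and]
    simp only [hP, Fin.sum_univ_six, Fin.sum_univ_three]
    simp
    refine and_congr ?_ ?_
    · refine ⟨fun h => ?_, fun h => ?_⟩ <;> linear_combination h
    · refine ⟨fun h => ?_, fun h => ?_⟩ <;> linear_combination h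
  have hsplit := Finset.card_filter_add_card_filter_not (s := Finset.univ.filter P)
    (fun p => p.1 3 = 0 ∧ p.2 = p.1 2)
  rw [Finset.filter_filter, Finset.filter_filter, hall] at hsplit
  rw [Finset.filter_filter] at key
  have e1 : (Finset.univ.filter (fun p => P p ∧ (p.1 3 = 0 ∧ p.2 = p.1 2))) =
    (Finset.univ.filter (fun p : (Fin 4 → F) × F => (p.1 3 = 0 ∧ p.2 = p.1 2) ∧ P p)) :=
    Finset.filter_congr (fun p _ => and_comm)
  have e2 : (Finset.univ.filter (fun p => P p ∧ ¬ (p.1 3 = 0 ∧ p.2 = p.1 2))) =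
    (Finset.univ.filter (fun p : (Fin 4 → F) × F => ¬ (p.1 3 = 0 ∧ p.2 = p.1 2) ∧ P p)) :=
    Finset.filter_congr (fun p _ => and_comm)
  rw [e1, e2] at hsplit
  change _ ≤ (Finset.univ.filter (fun p : (Fin 4 → F) × F =>
    ¬ (p.1 3 = 0 ∧ p.2 = p.1 2) ∧ P p)).card at key
  omega

theorem cnt_add {F V : Type*} [Field F] [AddCommGroup V] [Module F V]
    (S T : Multiset (Submodule F V)) (U : Submodule F V) :
    cnt (S + T) U = cnt S U + cnt T U := by
  simp [cnt]

theorem cnt_nsmul {F V : Type*} [Field F] [AddCommGroup V] [Module F V]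
    (n : ℕ) (S : Multiset (Submodule F V)) (U : Submodule F V) :
    cnt (n • S) U = n * cnt S U := by
  simp [cnt]

theorem cnt_sum {F V ι : Type*} [Field F] [AddCommGroup V] [Module F V]
    (s : Finset ι) (S : ι → Multiset (Submodule F V)) (U : Submodule F V) :
    cnt (∑ j ∈ s, S j) U = ∑ j ∈ s, cnt (S j) U := by
  induction s using Finset.induction_on with
  | empty => simp [cnt]
  | insert j s hj ih => rw [Finset.sum_insert hj, Finset.sum_insert hj, cnt_add, ih]

theorem cnt_cons {F V : Type*} [Field F] [AddCommGroup V] [Module F V]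
    (W : Submodule F V) (S : Multiset (Submodule F V)) (U : Submodule F V) :
    cnt (W ::ₘ S) U = cnt S U + if W ≤ U then 1 else 0 := by
  simp [cnt, Multiset.countP_cons]

/-- The general construction. -/
theorem construction (F : Type*) [Field F] [Fintype F] (q x m y z : ℕ)
    (hq : q = Fintype.card F) (hm : m ≤ q) :
    ∃ S : Multiset (Submodule F (Fin 6 → F)),
      Multiset.card S + m * q ^ 3 = x * q ^ 4 + m * q ^ 5 + y * (q ^ 2 + 1) + z * q ^ 2 ∧
      (∀ W ∈ S, Module.finrank F W ≤ 2) ∧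
      ∀ H : Submodule F (Fin 6 → F), Module.finrank F H = 5 →
        cnt S H ≤ (y * (q ^ 2 + 1) + z * q ^ 2) ∨
        cnt S H + m * q ≤ x * q ^ 2 + m * q ^ 3 + y + z ∨
        cnt S H + m * q ≤ x * q ^ 2 + m * q ^ 3 + y + (if m = 0 then 0 else q) := by
  obtain ⟨c4, hc4⟩ := exists_noroot F 3 (by norm_num)
  obtain ⟨c3, hc3⟩ := exists_noroot F 2 (by norm_num)
  obtain ⟨c2, hc2⟩ := exists_noroot F 1 (by norm_num)
  obtain ⟨T, -, hT⟩ := Finset.exists_subset_card_eq (s := (Finset.univ : Finset F)) (n := m)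
    (by rw [Finset.card_univ, ← hq]; exact hm)
  refine ⟨x • famA c4 + ∑ d ∈ T, famB c4 c3 d + y • (lineL F ::ₘ famC c2) + z • famC c2,
    ?_, ?_, ?_⟩
  · have h5 : ∑ d ∈ T, Multiset.card (famB c4 c3 d) + m * q ^ 3 = m * q ^ 5 := by
      have : ∑ d ∈ T, (Multiset.card (famB c4 c3 d) + q ^ 3) = ∑ d ∈ T, q ^ 5 :=
        Finset.sum_congr rfl (fun d _ => by rw [hq]; exact card_famB c4 c3 d)
      simpa [Finset.sum_add_distrib, hT] using this
    simp only [Multiset.card_add, Multiset.card_nsmul, Multiset.card_cons, card_famA,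
      card_famC, Multiset.card_sum, ← hq]
    linarith
  · intro W hW
    simp only [Multiset.mem_add] at hW
    rcases hW with ((hW | hW) | hW) | hW
    · exact fam_finrank _ _ _ W (Multiset.mem_of_mem_nsmul hW)
    · obtain ⟨d, _, hd⟩ := Multiset.mem_sum.1 hW
      exact fam_finrank _ _ _ W hd
    · rcases Multiset.mem_cons.1 (Multiset.mem_of_mem_nsmul hW) with rfl | h
      · exact finrank_pair _ _
      · exact fam_finrank _ _ _ W h
    · exact fam_finrank _ _ _ W (Multiset.mem_of_mem_nsmul hW)
  · intro H hH
    obtain ⟨φ, h0, hφ⟩ := exists_functional H hH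
    simp only [cnt_add, cnt_nsmul, cnt_sum, cnt_cons]
    have hA := cnt_famA c4 hc4 H φ hφ h0
    have hB := fun d => cnt_famB c4 c3 d hc4 hc3 H φ hφ h0
    have hC := cnt_famC c2 hc2 H φ hφ
    have hL := lineL_le H φ hφ
    rw [← hq] at hA hC
    simp only [← hq] at hB
    by_cases hψ : φ 0 = 0 ∧ φ 1 = 0 ∧ φ 2 = 0 ∧ φ 3 = 0
    · left
      rw [if_pos hψ] at hA
      rw [if_pos ⟨hψ.1, hψ.2.1⟩, if_pos hψ.2.2] at hC
      have hA' : cnt (famA c4) H = 0 := by omega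
      rw [hA', Finset.sum_eq_zero (fun d _ => (hB d).2 hψ)]
      have h1 : cnt (famC c2) H + (if lineL F ≤ H then 1 else 0) ≤ q ^ 2 + 1 := by
        split_ifs <;> omega
      have h2 := Nat.mul_le_mul_left y h1
      have h3 := Nat.mul_le_mul_left z hC
      omega
    right
    rw [if_neg hψ] at hA
    have h1 := Nat.mul_le_mul_left x hA
    by_cases h01 : φ 0 = 0 ∧ φ 1 = 0
    · right
      have h23 : ¬ (φ 2 = 0 ∧ φ 3 = 0) := fun h => hψ ⟨h01.1, h01.2, h⟩
      rw [if_pos h01, if_neg h23] at hC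
      have hC' : cnt (famC c2) H = 0 := by omega
      rw [hC']
      have h2 : y * (0 + if lineL F ≤ H then 1 else 0) ≤ y * 1 :=
        Nat.mul_le_mul_left y (by split_ifs <;> omega)
      have h3 : ∑ d ∈ T, cnt (famB c4 c3 d) H + m * q ≤ m * q ^ 3 + if m = 0 then 0 else q := by
        have e1 : ∑ d ∈ T, (cnt (famB c4 c3 d) H + q) ≤
            ∑ d ∈ T, (q ^ 3 + if φ 2 + d * φ 3 = 0 then q else 0) := by
          refine Finset.sum_le_sum (fun d _ => ?_)
          have := (hB d).1
          simp only [h01.1, h01.2, true_and] at this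
          split_ifs at this ⊢ <;> omega
        rw [Finset.sum_add_distrib, Finset.sum_add_distrib, Finset.sum_const, Finset.sum_const,
          hT, smul_eq_mul, smul_eq_mul, ← Finset.sum_filter, Finset.sum_const, smul_eq_mul] at e1
        have e2 : (T.filter (fun d => φ 2 + d * φ 3 = 0)).card ≤ 1 := by
          rw [Finset.card_le_one]
          intro d hd d' hd'
          have hd1 := (Finset.mem_filter.1 hd).2
          have hd2 := (Finset.mem_filter.1 hd').2
          have hne : φ 3 ≠ 0 := by
            intro h
            apply h23
            simp [h] at hd1
            exact ⟨hd1, h⟩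
          apply mul_right_cancel₀ hne
          linear_combination hd1 - hd2
        have e3 : (T.filter (fun d => φ 2 + d * φ 3 = 0)).card ≤ m :=
          (Finset.card_filter_le _ _).trans hT.le
        split_ifs with hm0
        · subst hm0
          have : (T.filter (fun d => φ 2 + d * φ 3 = 0)).card = 0 := by omega
          rw [this] at e1
          omega
        · have := Nat.mul_le_mul_right q e2
          omega
      omega
    · left
      rw [if_neg h01] at hC
      have hL' : ¬ lineL F ≤ H := fun h => h01 (hL h)
      rw [if_neg hL']
      have h2 := Nat.mul_le_mul_left y hC
      have h2' := Nat.mul_le_mul_left z hC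
      have h3 : ∑ d ∈ T, cnt (famB c4 c3 d) H + m * q ≤ m * q ^ 3 := by
        have e1 : ∑ d ∈ T, (cnt (famB c4 c3 d) H + q) ≤ ∑ d ∈ T, q ^ 3 := by
          refine Finset.sum_le_sum (fun d _ => ?_)
          have := (hB d).1
          rwa [if_neg (fun h => h01 ⟨h.1, h.2.1⟩)] at this
        simpa [Finset.sum_add_distrib, hT] using e1
      rw [add_zero]
      omega

theorem lower_bound (F : Type*) [Field F] [Fintype F] (q i a b t : ℕ)
    (hq : q = Fintype.card F) (hi : i ≤ q ^ 2)
    (hb : b ≤ q - 1) (hiab : (i : ℤ) = (a : ℤ) * (q : ℤ) - (b : ℤ)) (ht : q ^ 2 + q ≤ t) :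
    ∃ S : Multiset (Submodule F (Fin 6 → F)),
      Multiset.card S = (q ^ 4 + q ^ 2 + 1) * t - (q ^ 2 + 1) * i + (a - 2) * q ∧
      (∀ W ∈ S, Module.finrank F W ≤ 2) ∧
      ∀ H : Submodule F (Fin 6 → F), Module.finrank F H = 5 →
        cnt S H ≤ (q ^ 2 + 1) * t - i := by
  have hq1 : 1 < q := by rw [hq]; exact Fintype.one_lt_card
  have hn1 : (q ^ 2 + 1) * i ≤ (q ^ 4 + q ^ 2 + 1) * t := by
    apply Nat.mul_le_mul <;> nlinarith [Nat.zero_le (q ^ 4)]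
  have hn2 : i ≤ (q ^ 2 + 1) * t := by nlinarith [Nat.zero_le (q ^ 2 * t)]
  by_cases ha : a ≤ 1
  · obtain ⟨u, rfl⟩ : ∃ u, t = i + u := Nat.exists_eq_add_of_le (by nlinarith)
    obtain ⟨S, h1, h2, h3⟩ := construction F q (i + u) 0 u 0 hq (by omega)
    refine ⟨S, ?_, h2, fun H hH => ?_⟩
    · have ha2 : a - 2 = 0 := by omega
      rw [ha2]
      zify [hn1]
      zify at h1
      linarith
    · have h4 := h3 H hH
      rw [if_pos rfl] at h4
      have : cnt S H + i ≤ (q ^ 2 + 1) * (i + u) := by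
        have hii : i ≤ (q ^ 2 + 1) * i := Nat.le_mul_of_pos_left _ (by positivity)
        rcases h4 with h | h | h <;> linarith
      omega
  · have haq : a ≤ q := by
      by_contra h
      push Not at h
      have hb' : b + 1 ≤ q := by omega
      zify at *
      nlinarith
    obtain ⟨m, rfl⟩ : ∃ m, a = m + 1 := ⟨a - 1, by omega⟩
    obtain ⟨x, hx⟩ : ∃ x, t = m * q + x := Nat.exists_eq_add_of_le (by nlinarith)
    obtain ⟨y, hy⟩ : ∃ y, t + b = 2 * q + y := Nat.exists_eq_add_of_le (by nlinarith)
    obtain ⟨S, h1, h2, h3⟩ := construction F q x m y q hq (by omega)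
    have hm0 : m ≠ 0 := by omega
    obtain ⟨k, rfl⟩ : ∃ k, m = k + 1 := ⟨m - 1, by omega⟩
    refine ⟨S, ?_, h2, fun H hH => ?_⟩
    · have ha2 : k + 1 + 1 - 2 = k := by omega
      rw [ha2]
      zify [hn1]
      zify at h1 hx hy
      have hx' : (x : ℤ) = t - (k + 1) * q := by linarith
      have hy' : (y : ℤ) = t + b - 2 * q := by linarith
      push_cast at hiab
      rw [hx', hy'] at h1
      rw [hiab]
      linarith
    · have h4 := h3 H hH
      rw [if_neg hm0] at h4
      have : cnt S H + i ≤ (q ^ 2 + 1) * t := by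
        have hb' : b + 1 ≤ q := by omega
        zify at h4 hx hy hb' haq ⊢
        have hx' : (x : ℤ) = t - (k + 1) * q := by linarith
        have hy' : (y : ℤ) = t + b - 2 * q := by linarith
        push_cast at hiab
        rw [hx', hy'] at h4
        rw [hiab]
        rcases h4 with h | h | h
        · have hbb : ((q : ℤ) - 1 - b) * q ^ 2 ≥ 0 :=
            mul_nonneg (by linarith) (by positivity)
          have hkk : ((q : ℤ) - (k + 1 + 1)) * q ≥ 0 :=
            mul_nonneg (by linarith) (by positivity)
          nlinarith
        · linarith
        · linarith
      omega

theorem statement19 (F : Type*) [Field F] [Fintype F] (q i a b : ℕ)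
    (hq : q = Fintype.card F) (hi : i ≤ q ^ 2)
    (hb : b ≤ q - 1) (hiab : (i : ℤ) = (a : ℤ) * (q : ℤ) - (b : ℤ)) :
    ∀ t : ℕ, q ^ 2 + q ≤ t →
      -- `n_q(6,2;(q²+1)·t − i) = (q⁴+q²+1)·t − (q²+1)·i + max{a−2,0}·q`
      IsGreatest {n : ℕ | ∃ S : Multiset (Submodule F (Fin 6 → F)),
          Multiset.card S = n ∧ (∀ W ∈ S, Module.finrank F W ≤ 2) ∧
          ∀ H : Submodule F (Fin 6 → F), Module.finrank F H = 5 →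
            cnt S H ≤ (q ^ 2 + 1) * t - i}
        ((q ^ 4 + q ^ 2 + 1) * t - (q ^ 2 + 1) * i + (a - 2) * q) := by
  intro t ht
  refine ⟨lower_bound F q i a b t hq hi hb hiab ht, ?_⟩
  rintro n ⟨S, rfl, h2, h3⟩
  exact upper_bound F q i a b t hq hi hb hiab ht S h2 h3
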